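/- Determining sets have the exchange property in every finite tree T: whenever S and R are minimal determining sets for T and r ∈ R, there exists s ∈ S such that (S \ {s}) ∪ {r} is a minimal determining set. -/

import Mathlib

/-- `S` is a determining set for `G`. -/
def SimpleGraph.IsDeterminingSet {V : Type*} (G : SimpleGraph V) (S : Set V) : Prop :=
  ∀ g h : G ≃g G, (∀ s ∈ S, g s = h s) → g = h

/-- `S` is a minimal determining set for `G`. -/
def SimpleGraph.IsMinimalDeterminingSet {V : Type*} (G : SimpleGraph V) (S : Set V) : Prop :=
  G.IsDeterminingSet S ∧ ∀ T ⊂ S, ¬ G.IsDeterminingSet T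

namespace SimpleGraph

variable {V : Type*}

/-- A family of sets closed under symmetric differences of distinct intersecting members has
the exchange property for minimal transversals; `S` is a minimal transversal when each of its
elements is the only one in some member of the family. -/
theorem exists_exchange_of_symmDiff_mem [Finite V] {F : Set (Set V)}
    (hF : ∀ C ∈ F, ∀ D ∈ F, C ≠ D → (C ∩ D).Nonempty → symmDiff C D ∈ F) {S : Set V} {r : V}
    (hS : ∀ C ∈ F, (S ∩ C).Nonempty) (hmin : ∀ s ∈ S, ∃ C ∈ F, S ∩ C = {s})
    (hr : ∃ C ∈ F, r ∈ C) :
    ∃ s ∈ S, (∀ C ∈ F, ((S \ {s} ∪ {r}) ∩ C).Nonempty) ∧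
      ∀ t ∈ S \ {s} ∪ {r}, ∃ C ∈ F, (S \ {s} ∪ {r}) ∩ C = {t} := by
  by_cases hrS : r ∈ S
  · refine ⟨r, hrS, ?_⟩
    have : S \ {r} ∪ {r} = S := Set.sdiff_union_of_subset (by simpa using hrS)
    rw [this]
    exact ⟨hS, hmin⟩
  obtain ⟨s, hs, D, hD, hDs, hrD⟩ : ∃ s ∈ S, ∃ D ∈ F, S ∩ D = {s} ∧ r ∈ D := by
    obtain ⟨C, ⟨hC, hrC⟩, hCmin⟩ := (Set.toFinite {C | C ∈ F ∧ r ∈ C}).exists_minimalFor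
      (fun C => (S ∩ C).ncard) _ hr
    obtain ⟨s, hs, hsC⟩ := hS C hC
    obtain ⟨D, hD, hDs⟩ := hmin s hs
    have hD' : ∀ x, x ∈ S ∧ x ∈ D ↔ x = s := fun x => by
      simpa using Set.ext_iff.1 hDs x
    by_cases hrD : r ∈ D
    · exact ⟨s, hs, D, hD, hDs, hrD⟩
    exfalso
    have hsD := (hD' s).2 rfl
    have hE := hF C hC D hD (fun h => hrD (h ▸ hrC)) ⟨s, hsC, hsD.2⟩
    have hlt : (S ∩ symmDiff C D).ncard < (S ∩ C).ncard := by
      refine Set.ncard_lt_ncard ⟨?_, fun h => ?_⟩ (Set.toFinite _)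
      · rintro x ⟨hxS, hx | hx⟩
        · exact ⟨hxS, hx.1⟩
        · have := (hD' x).1 ⟨hxS, hx.1⟩
          exact ⟨hxS, this ▸ hsC⟩
      · have := (h ⟨hs, hsC⟩).2
        rw [Set.mem_symmDiff] at this
        tauto
    have := hCmin ⟨hE, Or.inl ⟨hrC, hrD⟩⟩ hlt.le
    exact absurd this (not_le.2 hlt)
  have hD' : ∀ x, x ∈ S ∧ x ∈ D ↔ x = s := fun x => by
    simpa using Set.ext_iff.1 hDs x
  have hsD := ((hD' s).2 rfl).2
  refine ⟨s, hs, fun C hC => ?_, ?_⟩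
  · by_contra hne
    have hno : ∀ x ∈ C, x ∈ S → x = s := fun x hx hxS => by
      by_contra hxs
      exact hne ⟨x, Or.inl ⟨hxS, hxs⟩, hx⟩
    have hrC : r ∉ C := fun h => hne ⟨r, Or.inr rfl, h⟩
    obtain ⟨x, hxS, hxC⟩ := hS C hC
    have hsC : s ∈ C := hno x hxC hxS ▸ hxC
    have hE := hF C hC D hD (fun h => hrC (h ▸ hrD)) ⟨s, hsC, hsD⟩
    obtain ⟨y, hyS, hy | hy⟩ := hS _ hE
    · exact hy.2 (hno y hy.1 hyS ▸ hsD)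
    · exact hy.2 ((hD' y).1 ⟨hyS, hy.1⟩ ▸ hsC)
  · rintro t (⟨htS, hts⟩ | rfl)
    · obtain ⟨C, hC, hCt⟩ := hmin t htS
      have hC' : ∀ x, x ∈ S ∧ x ∈ C ↔ x = t := fun x => by
        simpa using Set.ext_iff.1 hCt x
      rw [Set.mem_singleton_iff] at hts
      have htC := ((hC' t).2 rfl).2
      have hsC : s ∉ C := fun h => hts ((hC' s).1 ⟨hs, h⟩).symm
      have htD : t ∉ D := fun h => hts ((hD' t).1 ⟨htS, h⟩)
      have hrt : r ≠ t := fun h => hrS (h ▸ htS)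
      by_cases hrC : r ∈ C
      · refine ⟨_, hF C hC D hD (fun h => hsC (h ▸ hsD)) ⟨r, hrC, hrD⟩, ?_⟩
        ext x
        have := hC' x
        have := hD' x
        simp only [Set.mem_inter_iff, Set.mem_union, Set.mem_sdiff, Set.mem_singleton_iff,
          Set.mem_symmDiff]
        grind
      · refine ⟨C, hC, ?_⟩
        ext x
        have := hC' x
        simp only [Set.mem_inter_iff, Set.mem_union, Set.mem_sdiff, Set.mem_singleton_iff]
        grind
    · refine ⟨D, hD, ?_⟩
      ext x
      have := hD' x
      simp only [Set.mem_inter_iff, Set.mem_union, Set.mem_sdiff, Set.mem_singleton_iff]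
      grind

variable {T : SimpleGraph V}

/-- `C` is the set of vertices moved by some nontrivial automorphism of `T`. -/
def IsMotion (T : SimpleGraph V) (C : Set V) : Prop :=
  C.Nonempty ∧ ∃ g : T ≃g T, {x | g x ≠ x} = C

theorem isDeterminingSet_iff_forall_isMotion {S : Set V} :
    T.IsDeterminingSet S ↔ ∀ C, T.IsMotion C → (S ∩ C).Nonempty := by
  constructor
  · rintro h C ⟨⟨x, hx⟩, g, rfl⟩
    by_contra hne
    have := h g (Iso.refl) fun s hs => by
      by_contra hgs
      exact hne ⟨s, hs, hgs⟩
    exact hx (by simp [this])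
  · intro h g k hgk
    by_contra hne
    obtain ⟨x, hx⟩ : ∃ x, g x ≠ k x := by
      by_contra! hx
      exact hne (RelIso.ext hx)
    obtain ⟨s, hs, hs'⟩ := h {x | (g.trans k.symm) x ≠ x}
      ⟨⟨x, fun h' => hx ((k.toEquiv.symm_apply_eq).1 h')⟩, _, rfl⟩
    exact hs' ((k.toEquiv.symm_apply_eq).2 (hgk s hs))

theorem isDeterminingSet_iff_forall_minimal [Finite V] {S : Set V} :
    T.IsDeterminingSet S ↔ ∀ C, Minimal T.IsMotion C → (S ∩ C).Nonempty := by
  rw [isDeterminingSet_iff_forall_isMotion]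
  refine ⟨fun h C hC => h C hC.prop, fun h C hC => ?_⟩
  obtain ⟨D, hDC, hD⟩ := exists_minimal_le_of_wellFoundedLT T.IsMotion C hC
  exact (h D hD).mono (Set.inter_subset_inter_right S hDC)

theorem isMinimalDeterminingSet_iff [Finite V] {S : Set V} :
    T.IsMinimalDeterminingSet S ↔ (∀ C, Minimal T.IsMotion C → (S ∩ C).Nonempty) ∧
      ∀ s ∈ S, ∃ C, Minimal T.IsMotion C ∧ S ∩ C = {s} := by
  rw [IsMinimalDeterminingSet, isDeterminingSet_iff_forall_minimal]
  refine and_congr_right fun hS => ⟨fun h s hs => ?_, fun h R hR hdet => ?_⟩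
  · have := h (S \ {s}) ⟨Set.sdiff_subset, fun h' => (h' hs).2 rfl⟩
    rw [isDeterminingSet_iff_forall_minimal] at this
    push Not at this
    obtain ⟨C, hC, hne⟩ := this
    have hsub : S ∩ C ⊆ {s} := fun x hx => by
      by_contra hxs
      exact Set.notMem_empty x (hne ▸ ⟨⟨hx.1, hxs⟩, hx.2⟩)
    exact ⟨C, hC, (Set.Nonempty.subset_singleton_iff (hS C hC)).1 hsub⟩
  · obtain ⟨s, hs, hsR⟩ := Set.exists_of_ssubset hR
    obtain ⟨C, hC, hCs⟩ := h s hs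
    obtain ⟨x, hxR, hxC⟩ := isDeterminingSet_iff_forall_minimal.1 hdet C hC
    have : x ∈ ({s} : Set V) := hCs ▸ ⟨hR.1 hxR, hxC⟩
    exact hsR (this ▸ hxR)

theorem IsMotion.image {C : Set V} (hC : T.IsMotion C) (k : T ≃g T) : T.IsMotion (k '' C) := by
  obtain ⟨hne, g, rfl⟩ := hC
  refine ⟨hne.image k, (k.symm.trans g).trans k, ?_⟩
  ext x
  obtain ⟨y, rfl⟩ := k.surjective x
  simp

theorem minimal_isMotion_image {C : Set V} (hC : Minimal T.IsMotion C) (k : T ≃g T) :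
    Minimal T.IsMotion (k '' C) := by
  refine ⟨hC.prop.image k, fun D hD hDC => ?_⟩
  have h := hC.2 (hD.image k.symm) (by
    rintro _ ⟨y, hy, rfl⟩
    obtain ⟨x, hx, rfl⟩ := hDC hy
    simpa using hx)
  rintro _ ⟨x, hx, rfl⟩
  obtain ⟨y, hy, rfl⟩ := h hx
  simpa using hy

/-- `X` is connected in `T`: a set not separated by any edge inside `X` contains or misses `X`. -/
def IsConn (T : SimpleGraph V) (X : Set V) : Prop :=
  ∀ Y : Set V, (∀ x ∈ X, ∀ y ∈ X, T.Adj x y → x ∈ Y → y ∈ Y) → X ⊆ Y ∨ Disjoint X Y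

/-- `X` is the side of `a` after deleting the edge `va`. -/
structure IsBranch (T : SimpleGraph V) (v a : V) (X : Set V) : Prop where
  adj : T.Adj v a
  mem : a ∈ X
  notMem : v ∉ X
  eq_of_adj : ∀ x ∈ X, ∀ y, y ∉ X → T.Adj x y → x = a ∧ y = v
  isConn : T.IsConn X
  isConn_compl : T.IsConn Xᶜ

theorem isConn_setOf_reachable {G : SimpleGraph V} (hG : G ≤ T) (a : V) :
    T.IsConn {x | G.Reachable a x} := by
  intro Y hY
  by_cases h : Disjoint {x | G.Reachable a x} Y
  · exact Or.inr h
  obtain ⟨z, hz, hzY⟩ := Set.not_disjoint_iff.1 h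
  refine Or.inl fun x hx => ?_
  obtain ⟨p⟩ : G.Reachable z x := hz.symm.trans hx
  clear h hx
  induction p with
  | nil => exact hzY
  | cons hadj p ih =>
    have hmem := Reachable.trans hz hadj.reachable
    exact ih hmem (hY _ hz _ hmem (hG hadj) hzY)

theorem IsTree.exists_isBranch (hT : T.IsTree) {v a : V} (h : T.Adj v a) :
    ∃ X, T.IsBranch v a X := by
  set G := T.deleteEdges {s(v, a)} with hGdef
  have hGT : G ≤ T := deleteEdges_le _
  have hbr : ¬ G.Reachable v a :=
    isBridge_iff.1 (isAcyclic_iff_forall_adj_isBridge.1 hT.isAcyclic h)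
  have hadj : ∀ x y, T.Adj x y → G.Adj x y ∨ s(x, y) = s(v, a) := fun x y hxy => by
    by_cases he : s(x, y) = s(v, a)
    · exact Or.inr he
    · exact Or.inl (by simp [hGdef, deleteEdges_adj, hxy, he])
  have hcompl : {x | G.Reachable a x}ᶜ = {x | G.Reachable v x} := by
    ext x
    simp only [Set.mem_compl_iff, Set.mem_ofPred_eq]
    refine ⟨fun hx => ?_, fun hx hx' => hbr (hx.trans hx'.symm)⟩
    have key : ∀ x w, T.Walk x w → G.Reachable v w ∨ G.Reachable a w →
        G.Reachable v x ∨ G.Reachable a x := fun x w p hw => by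
      induction p with
      | nil => exact hw
      | cons hxy p ih =>
        rcases hadj _ _ hxy with h' | h'
        · exact (ih hw).imp (·.trans h'.symm.reachable) (·.trans h'.symm.reachable)
        · rcases Sym2.eq_iff.1 h' with ⟨rfl, rfl⟩ | ⟨rfl, rfl⟩
          · exact Or.inl (Reachable.refl _)
          · exact Or.inr (Reachable.refl _)
    obtain ⟨p⟩ := hT.connected.preconnected x v
    exact (key x v p (Or.inl (Reachable.refl _))).resolve_right hx
  refine ⟨{x | G.Reachable a x}, h, Reachable.refl _, fun h' => hbr h'.symm, ?_,
    isConn_setOf_reachable hGT a, hcompl ▸ isConn_setOf_reachable hGT v⟩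
  intro x hx y hy hxy
  rcases hadj _ _ hxy with h' | h'
  · exact absurd (Reachable.trans hx h'.reachable) hy
  · rcases Sym2.eq_iff.1 h' with ⟨rfl, rfl⟩ | ⟨rfl, rfl⟩
    · exact absurd (Reachable.symm hx) hbr
    · exact ⟨rfl, rfl⟩

theorem IsConn.image {X : Set V} (hX : T.IsConn X) (g : T ≃g T) : T.IsConn (g '' X) := by
  intro Y hY
  rcases hX (g ⁻¹' Y) fun x hx y hy hxy hxY =>
    hY _ ⟨x, hx, rfl⟩ _ ⟨y, hy, rfl⟩ (g.map_adj_iff.2 hxy) hxY with h | h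
  · exact Or.inl (Set.image_subset_iff.2 h)
  · refine Or.inr (Set.disjoint_left.2 ?_)
    rintro _ ⟨x, hx, rfl⟩ hxY
    exact Set.disjoint_left.1 h hx hxY

theorem IsBranch.image {v a : V} {X : Set V} (hX : T.IsBranch v a X) (g : T ≃g T) :
    T.IsBranch (g v) (g a) (g '' X) where
  adj := g.map_adj_iff.2 hX.adj
  mem := ⟨a, hX.mem, rfl⟩
  notMem := by
    rintro ⟨x, hx, h⟩
    exact hX.notMem (g.injective h ▸ hx)
  eq_of_adj := by
    rintro _ ⟨x, hx, rfl⟩ y hy hxy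
    obtain ⟨z, rfl⟩ := g.surjective y
    obtain ⟨rfl, rfl⟩ := hX.eq_of_adj x hx z (fun hz => hy ⟨z, hz, rfl⟩) (g.map_adj_iff.1 hxy)
    exact ⟨rfl, rfl⟩
  isConn := hX.isConn.image g
  isConn_compl := by
    rw [← Set.image_compl_eq g.bijective]
    exact hX.isConn_compl.image g

/-- A connected set that avoids an endpoint of the edge defining a branch is not split by it. -/
theorem IsBranch.subset_or_disjoint {v a : V} {X Y : Set V} (hX : T.IsBranch v a X)
    (hY : T.IsConn Y) (h : a ∉ Y ∨ v ∉ Y) : Y ⊆ X ∨ Disjoint Y X := by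
  refine hY X fun x hx y hy hxy hxX => ?_
  by_contra hyX
  obtain ⟨rfl, rfl⟩ := hX.eq_of_adj x hxX y hyX hxy
  tauto

theorem IsBranch.laminar [Finite V] {v a w b : V} {X Y : Set V} (hX : T.IsBranch v a X)
    (hY : T.IsBranch w b Y) (hXc : 2 * X.ncard < Nat.card V) (hYc : 2 * Y.ncard < Nat.card V) :
    X ⊆ Y ∨ Y ⊆ X ∨ Disjoint X Y := by
  by_cases h : b ∉ X ∨ w ∉ X
  · rcases hY.subset_or_disjoint hX.isConn h with h | h
    · exact Or.inl h
    · exact Or.inr (Or.inr h)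
  · rcases hY.subset_or_disjoint hX.isConn_compl (by simp; tauto) with h | h
    · have h1 := Set.ncard_le_ncard h (Set.toFinite _)
      have h2 := Set.ncard_add_ncard_compl X
      omega
    · exact Or.inr (Or.inl (Set.disjoint_compl_left_iff_subset.1 h))

/-- `σ` exchanges the branches `A` and `B` at the vertex `v` and fixes all other vertices. -/
structure IsSwap (T : SimpleGraph V) (σ : T ≃g T) (v : V) (A B : Set V) : Prop where
  left : ∃ a, T.IsBranch v a A
  right : ∃ b, T.IsBranch v b B
  disjoint : Disjoint A B
  image_left : σ '' A = B
  image_right : σ '' B = A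
  moved : ∀ x, σ x ≠ x ↔ x ∈ A ∪ B

theorem IsSwap.symm {σ : T ≃g T} {v : V} {A B : Set V} (h : T.IsSwap σ v A B) :
    T.IsSwap σ v B A :=
  ⟨h.right, h.left, h.disjoint.symm, h.image_right, h.image_left, fun x => by
    rw [h.moved, Set.union_comm]⟩

theorem IsSwap.two_mul_ncard_lt [Finite V] {σ : T ≃g T} {v : V} {A B : Set V}
    (h : T.IsSwap σ v A B) : 2 * A.ncard < Nat.card V := by
  obtain ⟨a, ha⟩ := h.left
  obtain ⟨b, hb⟩ := h.right
  have h1 : B.ncard = A.ncard := by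
    rw [← h.image_left, Set.ncard_image_of_injective _ σ.injective]
  have h2 := Set.ncard_union_eq h.disjoint (Set.toFinite _) (Set.toFinite _)
  have h3 : (A ∪ B).ncard < Nat.card V := by
    rw [← Set.ncard_univ]
    refine Set.ncard_lt_ncard ⟨Set.subset_univ _, fun h' => ?_⟩ (Set.toFinite _)
    exact (h' (Set.mem_univ v)).elim ha.notMem hb.notMem
  omega

theorem IsTree.exists_isSwap [Finite V] (hT : T.IsTree) {g : T ≃g T} {v a : V} (hv : g v = v)
    (hva : T.Adj v a) (ha : g a ≠ a) :
    ∃ (σ : T ≃g T) (A B : Set V), T.IsSwap σ v A B ∧ A ∪ B ⊆ {x | g x ≠ x} := by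
  classical
  obtain ⟨A, hA⟩ := hT.exists_isBranch hva
  have hB := hA.image g
  rw [hv] at hB
  set B := g '' A with hBdef
  have hdisj : Disjoint B A := by
    refine (hA.subset_or_disjoint hB.isConn (Or.inr hB.notMem)).resolve_left fun h => ?_
    exact ha (hA.eq_of_adj _ (h hB.mem) v hA.notMem hB.adj.symm).1
  have hgA : ∀ x ∈ A, g x ∈ B := fun x hx => ⟨x, hx, rfl⟩
  have hgB : ∀ x ∈ B, g.symm x ∈ A := by
    rintro _ ⟨x, hx, rfl⟩
    simpa using hx
  have hAB : ∀ x ∈ A, x ∉ B := fun x hx hx' => Set.disjoint_left.1 hdisj hx' hx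
  let f : V → V := fun x => if x ∈ A then g x else if x ∈ B then g.symm x else x
  have fA : ∀ x ∈ A, f x = g x := fun x hx => if_pos hx
  have fB : ∀ x ∈ B, f x = g.symm x := fun x hx => by
    simp only [f, if_neg (fun h => hAB x h hx), if_pos hx]
  have fN : ∀ x, x ∉ A → x ∉ B → f x = x := fun x h h' => by
    simp only [f, if_neg h, if_neg h']
  have hinv : Function.Involutive f := fun x => by
    by_cases hxA : x ∈ A
    · rw [fA x hxA, fB _ (hgA x hxA)]
      simp
    by_cases hxB : x ∈ B
    · rw [fB x hxB, fA _ (hgB x hxB)]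
      simp
    rw [fN x hxA hxB, fN x hxA hxB]
  have hfv : f v = v := fN v hA.notMem hB.notMem
  have hfa : f a = g a := fA a hA.mem
  have hfb : f (g a) = a := by rw [fB _ hB.mem]; simp
  have cross : ∀ x y, T.Adj x y → (x ∈ A ∧ y ∉ A ∨ x ∈ B ∧ y ∉ B) → T.Adj (f x) (f y) := by
    rintro x y hxy (⟨hx, hy⟩ | ⟨hx, hy⟩)
    · obtain ⟨rfl, rfl⟩ := hA.eq_of_adj x hx y hy hxy
      rw [hfv, hfa]
      exact hB.adj.symm
    · obtain ⟨rfl, rfl⟩ := hB.eq_of_adj x hx y hy hxy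
      rw [hfv, hfb]
      exact hA.adj.symm
  have hadj : ∀ x y, T.Adj x y → T.Adj (f x) (f y) := fun x y hxy => by
    by_cases h1 : x ∈ A ∧ y ∉ A ∨ x ∈ B ∧ y ∉ B
    · exact cross x y hxy h1
    by_cases h2 : y ∈ A ∧ x ∉ A ∨ y ∈ B ∧ x ∉ B
    · exact (cross y x hxy.symm h2).symm
    by_cases hxA : x ∈ A
    · rw [fA x hxA, fA y (by tauto)]
      exact g.map_adj_iff.2 hxy
    by_cases hxB : x ∈ B
    · rw [fB x hxB, fB y (by tauto)]
      exact g.symm.map_adj_iff.2 hxy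
    rwa [fN x hxA hxB, fN y (by tauto) (by tauto)]
  let σ : T ≃g T := ⟨hinv.toPerm f, fun {x y} =>
    ⟨fun h => by simpa [hinv x, hinv y] using hadj _ _ h, hadj x y⟩⟩
  have hσ : ∀ x, σ x = f x := fun _ => rfl
  have hfAB : ∀ x ∈ A, f x ∈ B := fun x hx => fA x hx ▸ hgA x hx
  have hfBA : ∀ x ∈ B, f x ∈ A := fun x hx => fB x hx ▸ hgB x hx
  refine ⟨σ, A, B, ⟨⟨a, hA⟩, ⟨_, hB⟩, hdisj.symm, ?_, ?_, fun x => ?_⟩, ?_⟩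
  · ext x
    exact ⟨by rintro ⟨y, hy, rfl⟩; exact hfAB y hy, fun hx => ⟨f x, hfBA x hx, hinv x⟩⟩
  · ext x
    exact ⟨by rintro ⟨y, hy, rfl⟩; exact hfBA y hy, fun hx => ⟨f x, hfAB x hx, hinv x⟩⟩
  · rw [hσ]
    refine ⟨fun h => ?_, ?_⟩
    · by_contra h'
      exact h (fN x (fun hx => h' (Or.inl hx)) (fun hx => h' (Or.inr hx)))
    · rintro (hx | hx) h
      · exact hAB x hx (h ▸ hfAB x hx)
      · exact hAB x (h ▸ hfBA x hx) hx
  · rintro x (hx | hx) h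
    · exact hAB x hx (h ▸ hgA x hx)
    · refine hAB x ?_ hx
      have := hgB x hx
      rwa [← h, RelIso.symm_apply_apply] at this

theorem IsSwap.isMotion {σ : T ≃g T} {v : V} {A B : Set V} (h : T.IsSwap σ v A B) :
    T.IsMotion (A ∪ B) :=
  have ⟨a, ha⟩ := h.left
  ⟨⟨a, Or.inl ha.mem⟩, σ, Set.ext h.moved⟩

theorem IsTree.exists_isSwap_of_minimal [Finite V] (hT : T.IsTree) {C : Set V}
    (hC : Minimal T.IsMotion C) (hne : C ≠ Set.univ) :
    ∃ (σ : T ≃g T) (v : V) (A B : Set V), T.IsSwap σ v A B ∧ A ∪ B = C := by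
  obtain ⟨⟨x, hx⟩, g, rfl⟩ := hC.prop
  obtain ⟨w, hw⟩ := (Set.ne_univ_iff_exists_notMem _).1 hne
  obtain ⟨p⟩ := hT.connected.preconnected w x
  obtain ⟨d, -, hd1, hd2⟩ := p.exists_boundary_dart {x | g x = x} (by simpa using hw) hx
  obtain ⟨σ, A, B, hσ, hsub⟩ := hT.exists_isSwap hd1 d.adj hd2
  exact ⟨σ, d.fst, A, B, hσ, hsub.antisymm (hC.2 hσ.isMotion hsub)⟩

theorem IsSwap.superset_of_subset [Finite V] {σ τ : T ≃g T} {v w : V} {A B A' B' : Set V}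
    (h : T.IsSwap σ v A B) (h' : T.IsSwap τ w A' B') (hmin : Minimal T.IsMotion (A' ∪ B'))
    (hsub : A ⊆ A') : A' ⊆ A := by
  obtain ⟨a, ha⟩ := h.left
  obtain ⟨b, hb⟩ := h.right
  obtain ⟨a', ha'⟩ := h'.left
  obtain ⟨b', hb'⟩ := h'.right
  have hBc := h.symm.two_mul_ncard_lt
  have hA'c := h'.two_mul_ncard_lt
  rcases hb.laminar ha' hBc hA'c with hl | hl | hl
  · have hle := hmin.2 h.isMotion (Set.union_subset (hsub.trans Set.subset_union_left)
      (hl.trans Set.subset_union_left))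
    have := Set.union_subset hsub hl (hle (Or.inr hb'.mem))
    exact (Set.disjoint_left.1 h'.disjoint this hb'.mem).elim
  · exact (Set.disjoint_left.1 h.disjoint ha.mem (hl (hsub ha.mem))).elim
  · have hbA' : b ∉ A' := Set.disjoint_left.1 hl hb.mem
    by_cases hv : v ∈ A'
    · rcases hb.subset_or_disjoint ha'.isConn_compl (Or.inr fun h => h hv) with h1 | h1
      · have h2 := Set.ncard_le_ncard h1 (Set.toFinite _)
        have h3 := Set.ncard_add_ncard_compl A'
        omega
      · exact (Set.disjoint_left.1 h1 hbA' hb.mem).elim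
    · rcases ha.subset_or_disjoint ha'.isConn (Or.inr hv) with h1 | h1
      · exact h1
      · exact (Set.disjoint_left.1 h1 (hsub ha.mem) ha.mem).elim

theorem IsSwap.eq_or_disjoint [Finite V] {σ τ : T ≃g T} {v w : V} {A B A' B' : Set V}
    (h : T.IsSwap σ v A B) (h' : T.IsSwap τ w A' B') (hmin : Minimal T.IsMotion (A ∪ B))
    (hmin' : Minimal T.IsMotion (A' ∪ B')) : A = A' ∨ Disjoint A A' := by
  obtain ⟨a, ha⟩ := h.left
  obtain ⟨a', ha'⟩ := h'.left
  rcases ha.laminar ha' h.two_mul_ncard_lt h'.two_mul_ncard_lt with hl | hl | hl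
  · exact Or.inl (hl.antisymm (h.superset_of_subset h' hmin' hl))
  · exact Or.inl ((h'.superset_of_subset h hmin hl).antisymm hl)
  · exact Or.inr hl

theorem IsTree.minimal_isMotion_symmDiff [Finite V] (hT : T.IsTree) {C D : Set V}
    (hC : Minimal T.IsMotion C) (hD : Minimal T.IsMotion D) (hne : C ≠ D)
    (hCD : (C ∩ D).Nonempty) : Minimal T.IsMotion (symmDiff C D) := by
  have hCu : C ≠ Set.univ := by
    rintro rfl
    exact hne ((hC.2 hD.prop (Set.subset_univ D)).antisymm (Set.subset_univ D))
  have hDu : D ≠ Set.univ := by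
    rintro rfl
    exact hne ((Set.subset_univ C).antisymm (hD.2 hC.prop (Set.subset_univ C)))
  obtain ⟨e, heC, heD⟩ := hCD
  obtain ⟨σ, v, A, B, hσ, rfl, heA⟩ : ∃ (σ : T ≃g T) (v : V) (A B : Set V),
      T.IsSwap σ v A B ∧ A ∪ B = C ∧ e ∈ A := by
    obtain ⟨σ, v, A, B, hσ, rfl⟩ := hT.exists_isSwap_of_minimal hC hCu
    rcases heC with h | h
    · exact ⟨σ, v, A, B, hσ, rfl, h⟩
    · exact ⟨σ, v, B, A, hσ.symm, Set.union_comm _ _, h⟩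
  obtain ⟨τ, w, A', B', hτ, rfl, heA'⟩ : ∃ (τ : T ≃g T) (w : V) (A' B' : Set V),
      T.IsSwap τ w A' B' ∧ A' ∪ B' = D ∧ e ∈ A' := by
    obtain ⟨σ, v, A, B, hσ, rfl⟩ := hT.exists_isSwap_of_minimal hD hDu
    rcases heD with h | h
    · exact ⟨σ, v, A, B, hσ, rfl, h⟩
    · exact ⟨σ, v, B, A, hσ.symm, Set.union_comm _ _, h⟩
  obtain rfl : A = A' := (hσ.eq_or_disjoint hτ hC hD).resolve_right fun h =>
    Set.disjoint_left.1 h heA heA'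
  have hBB : Disjoint B B' := (hσ.symm.eq_or_disjoint hτ.symm (by rwa [Set.union_comm])
    (by rwa [Set.union_comm])).resolve_left fun h => hne (by rw [h])
  have hAB := Set.disjoint_left.1 hσ.disjoint
  have hAB' := Set.disjoint_left.1 hτ.disjoint
  have hBB' := Set.disjoint_left.1 hBB
  have himg : σ '' B' = B' := by
    have hfix : ∀ x ∈ B', σ x = x := fun x hx => by
      by_contra h
      rcases (hσ.moved x).1 h with h | h
      · exact hAB' h hx
      · exact hBB' h hx
    rw [Set.image_congr hfix, Set.image_id']
  have : symmDiff (A ∪ B) (A ∪ B') = σ '' (A ∪ B') := by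
    rw [Set.image_union, hσ.image_left, himg]
    ext x
    have := @hAB x
    have := @hAB' x
    have := @hBB' x
    simp only [Set.mem_symmDiff, Set.mem_union]
    tauto
  rw [this]
  exact minimal_isMotion_image hD σ

end SimpleGraph

/-- Determining sets have the exchange property in every finite tree: whenever `S` and `R`
are minimal determining sets and `r ∈ R`, some `s ∈ S` may be exchanged for `r`. -/
theorem determining_exchange_in_trees {V : Type*} [Fintype V] (T : SimpleGraph V)
    (hT : T.IsTree) (S R : Set V)
    (hS : T.IsMinimalDeterminingSet S) (hR : T.IsMinimalDeterminingSet R)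
    (r : V) (hr : r ∈ R) :
    ∃ s ∈ S, T.IsMinimalDeterminingSet ((S \ {s}) ∪ {r}) := by
  rw [SimpleGraph.isMinimalDeterminingSet_iff] at hS hR
  obtain ⟨C, hC, hCr⟩ := hR.2 r hr
  have hrC : r ∈ R ∩ C := hCr ▸ rfl
  obtain ⟨s, hs, h⟩ := SimpleGraph.exists_exchange_of_symmDiff_mem
    (F := {C | Minimal T.IsMotion C})
    (fun C hC D hD hne h => hT.minimal_isMotion_symmDiff hC hD hne h)
    hS.1 hS.2 ⟨C, hC, hrC.2⟩
  exact ⟨s, hs, SimpleGraph.isMinimalDeterminingSet_iff.2 h⟩
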